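/- Let G be a finite p-group of derived length exactly d+1 (i.e., G^{(d)} ≠ 1 and G^{(d+1)} = 1) with d ≥ 2. Then log_p |G| ≥ 2^d + 2d - 2. -/

import Mathlib

namespace MannBound

open Subgroup
open scoped commutatorElement

variable {G : Type*} [Group G]

/-- Commutator containment modulo a normal subgroup, via the quotient map. -/
theorem commutator_le_iff_map (E A B : Subgroup G) [E.Normal] :
    ⁅A, B⁆ ≤ E ↔ ⁅A.map (QuotientGroup.mk' E), B.map (QuotientGroup.mk' E)⁆ = ⊥ := by
  rw [← map_commutator, Subgroup.map_eq_bot_iff, QuotientGroup.ker_mk']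

theorem sup_commutator_le (E A B C : Subgroup G) [E.Normal] (h1 : ⁅A, C⁆ ≤ E) (h2 : ⁅B, C⁆ ≤ E) :
    ⁅A ⊔ B, C⁆ ≤ E := by
  rw [commutator_le_iff_map, commutator_eq_bot_iff_le_centralizer] at *
  rw [Subgroup.map_sup]
  exact sup_le h1 h2

theorem three_subgroups (E A B C : Subgroup G) [E.Normal] (h1 : ⁅⁅B, C⁆, A⁆ ≤ E)
    (h2 : ⁅⁅C, A⁆, B⁆ ≤ E) : ⁅⁅A, B⁆, C⁆ ≤ E := by
  rw [commutator_le_iff_map, map_commutator] at *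
  exact commutator_commutator_eq_bot_of_rotate h1 h2

/-- `gam n` is the `(n+1)`-st term of the lower central series. -/
abbrev gam (G : Type*) [Group G] (n : ℕ) : Subgroup G := (⊤ : Subgroup G).lowerCentralSeries n

theorem gam_normal (n : ℕ) : (gam G n).Normal := by
  induction n with
  | zero => exact (inferInstance : (⊤ : Subgroup G).Normal)
  | succ n ih => exact Subgroup.commutator_normal (gam G n) ⊤

theorem gam_commutator (b : ℕ) : ∀ a : ℕ, ⁅gam G a, gam G b⁆ ≤ gam G (a + b + 1) := by
  induction b with
  | zero => intro a; exact le_refl _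
  | succ b ih =>
    intro a
    have := gam_normal (G := G) (a + (b + 1) + 1)
    rw [commutator_comm]
    change ⁅⁅gam G b, ⊤⁆, gam G a⁆ ≤ _
    apply three_subgroups
    · rw [commutator_comm ⊤]
      have := ih (a + 1)
      rwa [show a + 1 + b + 1 = a + (b + 1) + 1 by ring] at this
    · exact commutator_mono (ih a) le_rfl

theorem upper_commutator (k : ℕ) : ∀ n : ℕ,
    ⁅Subgroup.upperCentralSeries G (n + k + 1), gam G k⁆ ≤ Subgroup.upperCentralSeries G n := by
  induction k with
  | zero => intro n; exact Subgroup.commutator_upperCentralSeries_top_le G n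
  | succ k ih =>
    intro n
    rw [commutator_comm]
    change ⁅⁅gam G k, ⊤⁆, _⁆ ≤ _
    apply three_subgroups
    · rw [commutator_comm ⊤]
      exact (commutator_mono (Subgroup.commutator_upperCentralSeries_top_le G _) le_rfl).trans (ih n)
    · refine (commutator_mono ?_ le_rfl).trans (Subgroup.commutator_upperCentralSeries_top_le G n)
      have := ih (n + 1)
      rwa [show n + 1 + k + 1 = n + (k + 1) + 1 by ring] at this

theorem upper_strict [hn : Group.IsNilpotent G] (K : Subgroup G) [K.Normal] (j : ℕ)
    (h : K ⊓ Subgroup.upperCentralSeries G (j + 1) ≤ Subgroup.upperCentralSeries G j) :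
    K ≤ Subgroup.upperCentralSeries G j := by
  have key : ∀ n, K ⊓ Subgroup.upperCentralSeries G n ≤ Subgroup.upperCentralSeries G j := by
    intro n
    induction n with
    | zero => simp
    | succ n ih =>
      intro x hx
      refine h ⟨hx.1, ?_⟩
      refine Subgroup.mem_upperCentralSeries_succ_iff.2 ?_
      intro y
      refine ih ⟨?_, Subgroup.mem_upperCentralSeries_succ_iff.mp hx.2 y⟩
      exact (commutator_le_left K ⊤) (commutator_mem_commutator hx.1 (mem_top y))
  obtain ⟨n, hn⟩ := Group.IsNilpotent.nilpotent G
  have := key n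
  rwa [hn, inf_top_eq] at this

theorem card_lt_step {p : ℕ} (hp : p.Prime) [Finite G] (hG : IsPGroup p G) {H L : Subgroup G}
    (h : H < L) : p * Nat.card H ≤ Nat.card L := by
  have := Fact.mk hp
  obtain ⟨a, ha⟩ := (IsPGroup.iff_card).1 (hG.to_subgroup H)
  obtain ⟨b, hb⟩ := (IsPGroup.iff_card).1 (hG.to_subgroup L)
  have hle : Nat.card H < Nat.card L := by
    refine lt_of_le_of_ne (Subgroup.card_le_of_le h.le) fun he => ?_
    exact h.ne (Subgroup.eq_of_le_of_card_ge h.le he.ge)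
  rw [ha, hb] at *
  have := (Nat.pow_lt_pow_iff_right hp.one_lt).1 hle
  rw [← pow_succ']
  exact Nat.pow_le_pow_right hp.pos this

/-- The central case. -/
theorem hall_central {p : ℕ} (hp : p.Prime) [Finite G] (hG : IsPGroup p G) (K : Subgroup G)
    [K.Normal] (k : ℕ) (hK : K ≤ gam G k) (hc : ⁅K, K⁆ ≤ center G) (hne : ⁅K, K⁆ ≠ ⊥) :
    p ^ (k + 2) * Nat.card (⁅K, K⁆ : Subgroup G) ≤ Nat.card K ∧
    (Nat.card K = p ^ (k + 2) * Nat.card (⁅K, K⁆ : Subgroup G) → 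
      ∃ e, ⁅K, K⁆ = zpowers e) := by
  have := Fact.mk hp
  have hnil : Group.IsNilpotent G := hG.isNilpotent
  set Z := K ⊓ Subgroup.upperCentralSeries G (k + 1) with hZ
  have hcomm : ⁅Subgroup.upperCentralSeries G (k + 1), gam G k⁆ = ⊥ := by
    have := upper_commutator (G := G) k 0
    rw [zero_add] at this
    exact le_bot_iff.1 this
  have hnle : ¬ K ≤ Subgroup.upperCentralSeries G (k + 1) := fun h =>
    hne (le_bot_iff.1 ((commutator_mono h hK).trans hcomm.le))
  have hcard : ∀ j ≤ k, p ^ j * Nat.card (⁅K, K⁆ : Subgroup G) ≤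
      Nat.card (K ⊓ Subgroup.upperCentralSeries G (j + 1) : Subgroup G) := by
    intro j
    induction j with
    | zero =>
      intro _
      rw [pow_zero, one_mul]
      apply Subgroup.card_le_of_le
      rw [zero_add, Subgroup.upperCentralSeries_one]
      exact le_inf K.commutator_le_self hc
    | succ j ih =>
      intro hj
      have h1 := ih (by omega)
      have hlt : K ⊓ Subgroup.upperCentralSeries G (j + 1) < K ⊓ Subgroup.upperCentralSeries G (j + 1 + 1) := by
        refine lt_of_le_not_ge
          (inf_le_inf le_rfl (Subgroup.upperCentralSeries_mono G (by omega))) fun h => ?_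
        exact hnle ((upper_strict K (j + 1) (h.trans inf_le_right)).trans
          (Subgroup.upperCentralSeries_mono G (by omega)))
      have h2 := card_lt_step hp hG hlt
      calc p ^ (j + 1) * Nat.card (⁅K, K⁆ : Subgroup G)
          = p * (p ^ j * Nat.card (⁅K, K⁆ : Subgroup G)) := by ring
        _ ≤ _ := (Nat.mul_le_mul_left p h1).trans h2
  have hZcard : p ^ k * Nat.card (⁅K, K⁆ : Subgroup G) ≤ Nat.card Z := hcard k le_rfl
  have hZK : ⁅Z, K⁆ = ⊥ := le_bot_iff.1 ((commutator_mono inf_le_right hK).trans hcomm.le)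
  have hex : ∃ x ∈ K, ∃ y ∈ K, ⁅x, y⁆ ≠ 1 := by
    by_contra! hcon
    exact hne (le_bot_iff.1 (commutator_le.2 fun x hx y hy => by simpa using hcon x hx y hy))
  obtain ⟨x, hx, y, hy, hxy⟩ := hex
  have hxZ : x ∉ Z := fun h => hxy (by
    have := commutator_mem_commutator h hy
    rw [hZK] at this
    simpa using this)
  have hlt1 : Z < Z ⊔ zpowers x := by
    refine lt_of_le_not_ge le_sup_left fun h => hxZ (h ?_)
    exact (le_sup_right : zpowers x ≤ Z ⊔ zpowers x) (mem_zpowers x)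
  have hcen : Z ⊔ zpowers x ≤ centralizer {x} := by
    refine sup_le ?_ ?_
    · intro z hz
      rw [mem_centralizer_singleton_iff]
      have := commutator_mem_commutator hz hx
      rw [hZK, mem_bot, commutatorElement_eq_one_iff_mul_comm] at this
      exact this
    · rw [zpowers_le, mem_centralizer_singleton_iff]
  have hlt2 : Z ⊔ zpowers x < Z ⊔ zpowers x ⊔ zpowers y := by
    refine lt_of_le_not_ge le_sup_left fun h => hxy ?_
    have h3 : y ∈ centralizer {x} := hcen (h
      ((le_sup_right : zpowers y ≤ Z ⊔ zpowers x ⊔ zpowers y) (mem_zpowers y)))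
    rw [mem_centralizer_singleton_iff] at h3
    rw [commutatorElement_eq_one_iff_mul_comm, h3]
  have hle : Z ⊔ zpowers x ⊔ zpowers y ≤ K :=
    sup_le (sup_le inf_le_left ((zpowers_le).2 hx)) ((zpowers_le).2 hy)
  have c1 := card_lt_step hp hG hlt1
  have c2 := card_lt_step hp hG hlt2
  have c3 := Subgroup.card_le_of_le hle
  have c4 : p ^ (k + 2) * Nat.card (⁅K, K⁆ : Subgroup G) ≤
      Nat.card (Z ⊔ zpowers x ⊔ zpowers y : Subgroup G) := by
    calc p ^ (k + 2) * Nat.card (⁅K, K⁆ : Subgroup G)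
        = p * (p * (p ^ k * Nat.card (⁅K, K⁆ : Subgroup G))) := by ring
      _ ≤ p * (p * Nat.card Z) := by gcongr
      _ ≤ p * Nat.card (Z ⊔ zpowers x : Subgroup G) := by gcongr
      _ ≤ _ := c2
  refine ⟨c4.trans c3, fun heq => ⟨⁅x, y⁆, ?_⟩⟩
  have hKeq : Z ⊔ zpowers x ⊔ zpowers y = K :=
    Subgroup.eq_of_le_of_card_ge hle (heq.le.trans c4)
  have hcE : zpowers ⁅x, y⁆ ≤ center G :=
    (zpowers_le).2 (hc (commutator_mem_commutator hx hy))
  have hE : (zpowers ⁅x, y⁆).Normal := by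
    constructor
    intro n hn g
    have := mem_center_iff.1 (hcE hn) g
    rw [this, mul_inv_cancel_right]; exact hn
  apply le_antisymm
  · have hz : ∀ a b : G, ⁅a, b⁆ ∈ zpowers ⁅x, y⁆ → ⁅zpowers a, zpowers b⁆ ≤ zpowers ⁅x, y⁆ := by
      intro a b hab
      rw [commutator_le_iff_map, commutator_eq_bot_iff_le_centralizer]
      rw [MonoidHom.map_zpowers, MonoidHom.map_zpowers, zpowers_le, mem_centralizer_iff]
      have hcm : Commute (QuotientGroup.mk' (zpowers ⁅x, y⁆) a)
          (QuotientGroup.mk' (zpowers ⁅x, y⁆) b) := by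
        rw [← commutatorElement_eq_one_iff_commute, ← map_commutatorElement]
        exact (QuotientGroup.eq_one_iff _).2 hab
      rintro _ ⟨n, rfl⟩
      exact ((hcm.zpow_right n).eq).symm
    have hZx : ∀ a ∈ K, ⁅zpowers a, Z⁆ ≤ zpowers ⁅x, y⁆ := fun a ha => by
      rw [commutator_comm]
      exact ((commutator_mono le_rfl ((zpowers_le).2 ha)).trans hZK.le).trans bot_le
    have hK1 : ∀ a ∈ K, ⁅zpowers a, zpowers x⁆ ≤ zpowers ⁅x, y⁆ →
        ⁅zpowers a, zpowers y⁆ ≤ zpowers ⁅x, y⁆ → ⁅zpowers a, K⁆ ≤ zpowers ⁅x, y⁆ := by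
      intro a ha h1 h2
      rw [← hKeq, commutator_comm]
      refine sup_commutator_le _ _ _ _ (sup_commutator_le _ _ _ _ ?_ ?_) ?_
      · rw [commutator_comm]; exact hZx a ha
      · rw [commutator_comm]; exact h1
      · rw [commutator_comm]; exact h2
    have h0 : ⁅Z ⊔ zpowers x ⊔ zpowers y, K⁆ ≤ zpowers ⁅x, y⁆ := by
      refine sup_commutator_le _ _ _ _ (sup_commutator_le _ _ _ _ ?_ ?_) ?_
      · exact hZK.le.trans bot_le
      · exact hK1 x hx (hz _ _ (by simp)) (hz _ _ (mem_zpowers _))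
      · refine hK1 y hy (hz _ _ ?_) (hz _ _ (by simp))
        rw [← commutatorElement_inv x y]
        exact inv_mem (mem_zpowers _)
    rwa [hKeq] at h0
  · exact (zpowers_le).2 (commutator_mem_commutator hx hy)

theorem commutator_top_ne [hn : Group.IsNilpotent G] (N : Subgroup G) (h : ⁅N, (⊤ : Subgroup G)⁆ = N) :
    N = ⊥ := by
  have key : ∀ n, N ≤ gam G n := by
    intro n
    induction n with
    | zero => exact le_top
    | succ n ih => rw [← h]; exact commutator_mono ih le_rfl
  obtain ⟨n, hn⟩ := Subgroup.nilpotent_iff_lowerCentralSeries.1 hn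
  exact le_bot_iff.1 ((key n).trans hn.le)

/-- Hall's bound together with the information in the case of equality. -/
theorem hall {p : ℕ} (hp : p.Prime) [Finite G] (hG : IsPGroup p G) (K : Subgroup G)
    [K.Normal] (k : ℕ) (hK : K ≤ gam G k) (hne : ⁅K, K⁆ ≠ ⊥) :
    p ^ (k + 2) ≤ (⁅K, K⁆).relIndex K ∧
    ((⁅K, K⁆).relIndex K = p ^ (k + 2) → 
      ⁅⁅K, K⁆, ⁅K, K⁆⁆ ≤ ⁅⁅K, K⁆, ⁅⁅K, K⁆, (⊤ : Subgroup G)⁆⁆) := by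
  have := Fact.mk hp
  have hnil : Group.IsNilpotent G := hG.isNilpotent
  set D := ⁅K, K⁆ with hD
  set N := ⁅D, (⊤ : Subgroup G)⁆ with hN
  have hND : N ≤ D := commutator_le_left D ⊤
  have hDK : D ≤ K := K.commutator_le_self
  set f := QuotientGroup.mk' N with hf
  have hfs : Function.Surjective f := QuotientGroup.mk'_surjective N
  have hker : f.ker = N := QuotientGroup.ker_mk' N
  have hKn : (K.map f).Normal := Subgroup.Normal.map inferInstance f hfs
  have hmD : ⁅K.map f, K.map f⁆ = D.map f := (map_commutator K K f).symm
  have hKg : K.map f ≤ gam (G ⧸ N) k := by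
    refine (Subgroup.map_mono hK).trans ?_
    rw [Subgroup.map_lowerCentralSeries]
    exact Subgroup.lowerCentralSeries_mono k le_top
  have hrel : (D.map f).relIndex (K.map f) = D.relIndex K := by
    rw [relIndex_map_map, hker, sup_eq_left.2 hND, sup_eq_left.2 (hND.trans hDK)]
  have hcard : D.relIndex K * Nat.card (D.map f) = Nat.card (K.map f) := by
    rw [← hrel, ← relIndex_bot_left, ← relIndex_bot_left, mul_comm]
    exact relIndex_mul_relIndex _ _ _ bot_le (Subgroup.map_mono hDK)
  have hpos : 0 < Nat.card (D.map f) := Nat.card_pos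
  have hmain := hall_central hp (hG.to_quotient N) (K.map f) k hKg (by
      rw [hmD, ← commutator_top_right_eq_bot_iff_le_center, ← map_top_of_surjective f hfs,
        ← map_commutator, Subgroup.map_eq_bot_iff, hker]) (by
      rw [hmD]
      intro h
      rw [Subgroup.map_eq_bot_iff, hker] at h
      exact hne (commutator_top_ne D (le_antisymm hND h)))
  rw [hmD, ← hcard] at hmain
  refine ⟨Nat.le_of_mul_le_mul_right hmain.1 hpos, fun heq => ?_⟩
  obtain ⟨e', he⟩ := hmain.2 (by rw [heq])
  obtain ⟨e, rfl⟩ := hfs e'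
  have hDe : D = zpowers e ⊔ N := by
    rw [← MonoidHom.map_zpowers] at he
    have := congrArg (Subgroup.comap f) he
    rwa [comap_map_eq, comap_map_eq, hker, sup_eq_left.2 hND] at this
  have heD : zpowers e ≤ D := hDe ▸ le_sup_left
  have h1 : ⁅N, D⁆ ≤ ⁅D, N⁆ := (commutator_comm N D).le
  have h2 : ⁅zpowers e ⊔ N, D⁆ ≤ ⁅D, N⁆ := by
    refine sup_commutator_le _ _ _ _ ?_ h1
    rw [commutator_comm]
    have : ⁅zpowers e ⊔ N, zpowers e⁆ ≤ ⁅D, N⁆ := by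
      refine sup_commutator_le _ _ _ _ ?_ ((commutator_mono le_rfl heD).trans h1)
      refine le_trans (le_of_eq ?_) bot_le
      rw [commutator_self_eq_bot_iff]
      infer_instance
    rwa [← hDe] at this
  rwa [← hDe] at h2

theorem derived_step {i n : ℕ} (h : derivedSeries G i ≤ gam G n) :
    derivedSeries G (i + 1) ≤ gam G (2 * n + 1) := by
  rw [derivedSeries_succ]
  refine (commutator_mono h h).trans ((gam_commutator n n).trans_eq ?_)
  rw [two_mul]

theorem derived_le_gam (i : ℕ) : derivedSeries G i ≤ gam G (2 ^ i - 1) := by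
  induction i with
  | zero => exact le_top
  | succ i ih =>
    have := derived_step ih
    rwa [show 2 * (2 ^ i - 1) + 1 = 2 ^ (i + 1) - 1 by
      have := Nat.one_le_two_pow (n := i); rw [pow_succ]; omega] at this

theorem derived_le_gam' {i : ℕ} (h : derivedSeries G i ≤ gam G (2 ^ i)) {j : ℕ} (hij : i ≤ j) :
    derivedSeries G j ≤ gam G (2 ^ j) := by
  induction j, hij using Nat.le_induction with
  | base => exact h
  | succ j _ ih =>
    refine (derived_step ih).trans (Subgroup.lowerCentralSeries_antitone _ ?_)
    rw [pow_succ]; omega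

/-- Mann's theorem: if level `i` attains Hall's bound then no level `j ≥ i + 2` does. -/
theorem mann {p : ℕ} (hp : p.Prime) [Finite G] (hG : IsPGroup p G) {i j : ℕ} (hij : i + 2 ≤ j)
    (hj : derivedSeries G (j + 1) ≠ ⊥)
    (hi : (derivedSeries G (i + 1)).relIndex (derivedSeries G i) = p ^ (2 ^ i + 1)) :
    p ^ (2 ^ j + 2) ≤ (derivedSeries G (j + 1)).relIndex (derivedSeries G j) := by
  have hi1 : derivedSeries G (i + 1) ≠ ⊥ := fun h => hj (le_bot_iff.1
    ((derivedSeries_antitone G (show i + 1 ≤ j + 1 by omega)).trans h.le))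
  have hn1 := derivedSeries_normal G i
  have hn2 := derivedSeries_normal G j
  have h := (hall hp hG (derivedSeries G i) (2 ^ i - 1) (derived_le_gam i) hi1).2
    (by rw [← derivedSeries_succ, hi]; congr 1; have := Nat.one_le_two_pow (n := i); omega)
  have hle : derivedSeries G (i + 2) ≤ gam G (2 ^ (i + 2)) := by
    refine h.trans ?_
    rw [← derivedSeries_succ]
    have h1 := derived_le_gam (G := G) (i + 1)
    refine (commutator_mono h1 (commutator_mono h1 le_rfl)).trans
      ((gam_commutator (2 ^ (i + 1) - 1 + 1) _).trans_eq ?_)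
    congr 1
    have := Nat.one_le_two_pow (n := i)
    simp only [pow_succ]; omega
  exact (hall hp hG (derivedSeries G j) (2 ^ j) (derived_le_gam' hle hij) hj).1

theorem card_prod [Finite G] (n : ℕ) : Nat.card G =
    (∏ i ∈ Finset.range n, (derivedSeries G (i + 1)).relIndex (derivedSeries G i)) *
      Nat.card (derivedSeries G n) := by
  induction n with
  | zero => simp
  | succ n ih =>
    rw [Finset.prod_range_succ, ih, mul_assoc]
    congr 1
    rw [← relIndex_bot_left, ← relIndex_bot_left, mul_comm]
    exact (relIndex_mul_relIndex _ _ _ bot_le (derivedSeries_antitone G (Nat.le_succ n))).symm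

end MannBound

/-- Mann's bound: if `G` is a finite `p`-group of derived length exactly `d + 1`
(with `d ≥ 2`), then `|G| ≥ p^(2^d + 2d - 2)`. -/
theorem order_bound_of_derived_length {p : ℕ} (hp : p.Prime) {G : Type*} [Group G]
    [Finite G] (hG : IsPGroup p G) (d : ℕ) (hd : 2 ≤ d)
    (h1 : derivedSeries G d ≠ ⊥) (h2 : derivedSeries G (d + 1) = ⊥) :
    p ^ (2 ^ d + 2 * d - 2) ≤ Nat.card G := by
  have := Fact.mk hp
  have hrel : ∀ i, ∃ e, (derivedSeries G (i + 1)).relIndex (derivedSeries G i) = p ^ e := by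
    intro i
    obtain ⟨a, ha⟩ := (IsPGroup.iff_card).1 (hG.to_subgroup (derivedSeries G i))
    obtain ⟨e, _, he⟩ := (Nat.dvd_prime_pow hp).1
      (ha ▸ Subgroup.relIndex_dvd_card (derivedSeries G (i + 1)) (derivedSeries G i))
    exact ⟨e, he⟩
  choose e he using hrel
  have hnb : ∀ j < d, derivedSeries G (j + 1) ≠ ⊥ := fun j hj h => h1 (le_bot_iff.1
    ((derivedSeries_antitone G (show j + 1 ≤ d by omega)).trans h.le))
  have hH : ∀ j < d, 2 ^ j + 1 ≤ e j := by
    intro j hj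
    have hn := derivedSeries_normal G j
    have h := (MannBound.hall hp hG (derivedSeries G j) (2 ^ j - 1)
      (MannBound.derived_le_gam j) (hnb j hj)).1
    rw [← derivedSeries_succ, he] at h
    have := (Nat.pow_le_pow_iff_right hp.one_lt).1 h
    omega
  have hM : ∃ i, ∀ j < d, j ≠ i → j ≠ i + 1 → 2 ^ j + 2 ≤ e j := by
    by_cases hex : ∃ i, i < d ∧ e i = 2 ^ i + 1
    · classical
      refine ⟨Nat.find hex, fun j hj h3 h4 => ?_⟩
      have hs := Nat.find_spec hex
      rcases lt_or_ge j (Nat.find hex) with hlt | hge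
      · have := Nat.find_min hex hlt
        have := hH j hj
        grind
      · have h := MannBound.mann hp hG (i := Nat.find hex) (j := j) (by omega) (hnb j hj)
          (by rw [he, hs.2])
        rw [he] at h
        exact (Nat.pow_le_pow_iff_right hp.one_lt).1 h
    · refine ⟨0, fun j hj _ _ => ?_⟩
      have := hH j hj
      grind
  obtain ⟨i, hi⟩ := hM
  have hsum : ∀ n ≤ d, ∑ j ∈ Finset.range n, (2 ^ j + 2) ≤ ∑ j ∈ Finset.range n, e j + 2 := by
    intro n hn
    have h3 : ∑ j ∈ Finset.range n, (2 ^ j + 2) ≤ ∑ j ∈ Finset.range n,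
        (e j + (if j = i then 1 else 0) + (if j = i + 1 then 1 else 0)) := by
      refine Finset.sum_le_sum fun j hj => ?_
      have hj' : j < d := lt_of_lt_of_le (Finset.mem_range.1 hj) hn
      have := hH j hj'
      have := hi j hj'
      grind
    rw [Finset.sum_add_distrib (f := fun j => e j + (if j = i then 1 else 0)),
      Finset.sum_add_distrib (f := e), Finset.sum_ite_eq', Finset.sum_ite_eq'] at h3
    refine h3.trans ?_
    split_ifs <;> omega
  have hgeo : ∀ n : ℕ, ∑ j ∈ Finset.range n, (2 ^ j + 2) + 1 = 2 ^ n + 2 * n := by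
    intro n
    induction n with
    | zero => simp
    | succ n ih => rw [Finset.sum_range_succ, pow_succ]; omega
  have hlast : p ≤ Nat.card (derivedSeries G d) := by
    have := MannBound.card_lt_step hp hG (bot_lt_iff_ne_bot.2 h1)
    simpa using this
  rw [MannBound.card_prod (G := G) d]
  simp only [he]
  rw [Finset.prod_pow_eq_pow_sum]
  calc p ^ (2 ^ d + 2 * d - 2) ≤ p ^ (∑ j ∈ Finset.range d, e j + 1) := by
        apply Nat.pow_le_pow_right hp.pos
        have := hsum d le_rfl
        have := hgeo d
        omega
    _ = p ^ (∑ j ∈ Finset.range d, e j) * p := pow_succ _ _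
    _ ≤ _ := Nat.mul_le_mul_left _ hlast
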